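/- Let R be a commutative noetherian ring and X, Y, Z finitely generated R-modules. Then step(X,Z) ≤ step(X,Y) + step(Y,Z), where the inequality is taken in the extended natural numbers. -/

import Mathlib

open CategoryTheory

noncomputable section

variable (R : Type) [CommRing R]

/-- The nonfree locus of a module: primes where the localization is not free. -/
def nonfreeLocus (M : ModuleCat R) : Set (PrimeSpectrum R) :=
  {p | ¬ Module.Free (Localization.AtPrime p.asIdeal)
      (LocalizedModule p.asIdeal.primeCompl M)}

/-- The nonfree locus of a class of modules. -/
def nonfreeLocusSet (𝒳 : Set (ModuleCat R)) : Set (PrimeSpectrum R) :=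
  ⋃ X ∈ 𝒳, nonfreeLocus R X

/-- `N` is a direct summand of `M`. -/
def IsSummand (N M : ModuleCat R) : Prop :=
  ∃ (i : N ⟶ M) (p : M ⟶ N), i ≫ p = 𝟙 N

/-- `0 → L → M → N → 0` is a short exact sequence. -/
def SES (L M N : ModuleCat R) : Prop :=
  ∃ (f : L ⟶ M) (g : M ⟶ N),
    Function.Injective f ∧ Function.Surjective g ∧ Function.Exact f g

/-- A resolving class of finitely generated modules. -/
structure IsResolving (𝒳 : Set (ModuleCat R)) : Prop where
  finite : ∀ M ∈ 𝒳, Module.Finite R M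
  iso_closed : ∀ M N : ModuleCat R, Nonempty (M ≅ N) → M ∈ 𝒳 → N ∈ 𝒳
  proj_mem : ∀ M : ModuleCat R, Module.Finite R M → Module.Projective R M → M ∈ 𝒳
  summand_closed : ∀ M N : ModuleCat R, IsSummand R N M → M ∈ 𝒳 → N ∈ 𝒳
  ext_closed : ∀ L M N : ModuleCat R, SES R L M N → L ∈ 𝒳 → N ∈ 𝒳 → M ∈ 𝒳
  ker_epi_closed : ∀ L M N : ModuleCat R, SES R L M N → M ∈ 𝒳 → N ∈ 𝒳 → L ∈ 𝒳

/-- The resolving closure of a class of modules. -/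
def resClosure (𝒳 : Set (ModuleCat R)) : Set (ModuleCat R) :=
  ⋂₀ {𝒴 | IsResolving R 𝒴 ∧ 𝒳 ⊆ 𝒴}

/-- Finite direct sum of a family of modules. -/
def finDirectSum {n : ℕ} (f : Fin n → ModuleCat R) : ModuleCat R :=
  ModuleCat.of R (∀ i, f i)

/-- The class `res^n X`. -/
def resStep (X : ModuleCat R) : ℕ → Set (ModuleCat R)
  | 0 => {M | ∃ (n : ℕ) (f : Fin n → ModuleCat R),
      (∀ i, f i = X ∨ f i = ModuleCat.of R R) ∧ IsSummand R M (finDirectSum R f)}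
  | (n+1) => {M | ∃ (t : ℕ) (f : Fin t → ModuleCat R),
      (∀ i, (∃ A B, A ∈ resStep X n ∧ B ∈ resStep X n ∧ SES R A (f i) B) ∨
            (∃ A B, A ∈ resStep X n ∧ B ∈ resStep X n ∧ SES R (f i) A B)) ∧
      IsSummand R M (finDirectSum R f)}

/-- `step(X,Y)` : the least `n` with `Y ∈ res^n X`. -/
def step (X Y : ModuleCat R) : ℕ∞ :=
  sInf {n : ℕ∞ | ∃ m : ℕ, n = (m : ℕ∞) ∧ Y ∈ resStep R X m}

/-- A module is indecomposable. -/
def Indec (M : ModuleCat R) : Prop :=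
  Nontrivial M ∧ ∀ (A B : ModuleCat R), Nontrivial A → Nontrivial B →
    IsEmpty (M ≅ ModuleCat.of R (A × B))

/-- `Ext¹`. -/
def ext1 (X Y : ModuleCat R) : ModuleCat R :=
  ((Ext R (ModuleCat R) 1).obj (Opposite.op X)).obj Y

/-- Dimension of a subset of `Spec R` : `sup { dim R/p }`. -/
def dimSet (Z : Set (PrimeSpectrum R)) : WithBot ℕ∞ :=
  ⨆ p ∈ Z, ringKrullDim (R ⧸ (p : PrimeSpectrum R).asIdeal)

/-- The height of `p` with respect to a subset `Z` of `Spec R`. -/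
def heightWithin (Z : Set (PrimeSpectrum R)) (p : PrimeSpectrum R) : ℕ∞ :=
  ⨆ q ∈ Z, ⨆ (h : q ≤ p), Order.height (α := Set.Icc q p) ⟨p, ⟨h, le_rfl⟩⟩

/-- Depth of a module over a local ring : the supremum of lengths of regular
sequences contained in the maximal ideal. -/
def moduleDepth [IsLocalRing R] (M : Type) [AddCommGroup M] [Module R M] : ℕ∞ :=
  ⨆ (rs : List R) (_ : (∀ r ∈ rs, r ∈ IsLocalRing.maximalIdeal R) ∧
      RingTheory.Sequence.IsRegular M rs), (rs.length : ℕ∞)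

/-- The singular locus: primes `p` such that `R_p` is not regular, i.e. the maximal
ideal of `R_p` cannot be generated by `dim R_p` elements. -/
def singularLocus : Set (PrimeSpectrum R) :=
  {p | ¬ ∃ (s : Finset (Localization.AtPrime p.asIdeal)),
      Ideal.span (s : Set (Localization.AtPrime p.asIdeal)) =
        IsLocalRing.maximalIdeal (Localization.AtPrime p.asIdeal) ∧
      (s.card : WithBot ℕ∞) = ringKrullDim (Localization.AtPrime p.asIdeal)}

end

section ResStep

variable {R : Type} [CommRing R]

theorem IsSummand.trans {L M N : ModuleCat.{0} R} (h₁ : IsSummand R L M)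
    (h₂ : IsSummand R M N) : IsSummand R L N := by
  obtain ⟨i, p, h⟩ := h₁
  obtain ⟨j, q, h'⟩ := h₂
  exact ⟨i ≫ j, q ≫ p, by rw [Category.assoc, ← Category.assoc j, h', Category.id_comp, h]⟩

theorem IsSummand.of_linearEquiv {M N : ModuleCat.{0} R} (e : M ≃ₗ[R] N) : IsSummand R M N :=
  ⟨e.toModuleIso.hom, e.toModuleIso.inv, e.toModuleIso.hom_inv_id⟩

theorem IsSummand.pi {ι : Type} {f g : ι → ModuleCat.{0} R}
    (h : ∀ i, IsSummand R (f i) (g i)) :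
    IsSummand R (ModuleCat.of R (∀ i, f i)) (ModuleCat.of R (∀ i, g i)) := by
  choose s p hsp using h
  refine ⟨ModuleCat.ofHom (LinearMap.piMap fun i => (s i).hom),
    ModuleCat.ofHom (LinearMap.piMap fun i => (p i).hom), ?_⟩
  ext x i
  exact congrArg (fun φ => φ.hom (x i)) (hsp i)

/-- The class of direct summands of finite direct sums of modules satisfying `P`. -/
def addClosure (P : ModuleCat.{0} R → Prop) : Set (ModuleCat.{0} R) :=
  {M | ∃ (n : ℕ) (f : Fin n → ModuleCat.{0} R),
    (∀ i, P (f i)) ∧ IsSummand R M (finDirectSum R f)}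

theorem mem_addClosure_of_isSummand_pi {P : ModuleCat.{0} R → Prop} {M : ModuleCat.{0} R}
    {ι : Type} [Finite ι] (f : ι → ModuleCat.{0} R) (hf : ∀ i, P (f i))
    (h : IsSummand R M (ModuleCat.of R (∀ i, f i))) : M ∈ addClosure P := by
  obtain ⟨n, ⟨e⟩⟩ := Finite.exists_equiv_fin ι
  exact ⟨n, fun k => f (e.symm k), fun k => hf _,
    h.trans (.of_linearEquiv (LinearEquiv.piCongrLeft' R (fun i => f i) e))⟩

theorem mem_addClosure {P : ModuleCat.{0} R → Prop} {M : ModuleCat.{0} R} (h : P M) :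
    M ∈ addClosure P :=
  mem_addClosure_of_isSummand_pi (fun _ : Unit => M) (fun _ => h)
    (.of_linearEquiv (LinearEquiv.funUnique Unit R M).symm)

theorem addClosure_mono {P Q : ModuleCat.{0} R → Prop} (h : ∀ M, P M → Q M) :
    addClosure P ⊆ addClosure Q :=
  fun _ ⟨n, f, hf, hM⟩ => ⟨n, f, fun i => h _ (hf i), hM⟩

theorem addClosure_addClosure_subset (P : ModuleCat.{0} R → Prop) :
    addClosure (· ∈ addClosure P) ⊆ addClosure P := by
  rintro M ⟨n, f, hf, hM⟩
  choose k g hg hs using hf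
  refine mem_addClosure_of_isSummand_pi (fun x : Σ i, Fin (k i) => g x.1 x.2)
    (fun x => hg _ _) (hM.trans ((IsSummand.pi hs).trans (.of_linearEquiv ?_)))
  exact (LinearEquiv.piCurry R (fun i j => (g i j : Type))).symm

theorem resStep_zero (X : ModuleCat.{0} R) :
    resStep R X 0 = addClosure fun M => M = X ∨ M = ModuleCat.of R R :=
  rfl

theorem resStep_succ (X : ModuleCat.{0} R) (n : ℕ) :
    resStep R X (n + 1) = addClosure fun M =>
      (∃ A B, A ∈ resStep R X n ∧ B ∈ resStep R X n ∧ SES R A M B) ∨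
        (∃ A B, A ∈ resStep R X n ∧ B ∈ resStep R X n ∧ SES R M A B) :=
  rfl

theorem addClosure_resStep_subset (X : ModuleCat.{0} R) (n : ℕ) :
    addClosure (· ∈ resStep R X n) ⊆ resStep R X n := by
  cases n with
  | zero => exact resStep_zero X ▸ addClosure_addClosure_subset _
  | succ n => exact resStep_succ X n ▸ addClosure_addClosure_subset _

theorem zero_mem_resStep (X : ModuleCat.{0} R) (n : ℕ) :
    ModuleCat.of R PUnit ∈ resStep R X n :=
  addClosure_resStep_subset X n
    ⟨0, Fin.elim0, fun i => i.elim0, 0, 0, by ext⟩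

theorem resStep_subset_succ (X : ModuleCat.{0} R) (n : ℕ) :
    resStep R X n ⊆ resStep R X (n + 1) := by
  intro M hM
  rw [resStep_succ]
  exact mem_addClosure <| .inl ⟨M, ModuleCat.of R PUnit, hM, zero_mem_resStep X n,
    𝟙 M, 0, Function.injective_id, fun y => ⟨0, Subsingleton.elim _ _⟩,
    fun y => ⟨fun _ => ⟨y, rfl⟩, fun _ => Subsingleton.elim _ _⟩⟩

theorem self_mem_resStep (X : ModuleCat.{0} R) (n : ℕ) : ModuleCat.of R R ∈ resStep R X n := by
  induction n with
  | zero => exact resStep_zero X ▸ mem_addClosure (.inr rfl)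
  | succ n ih => exact resStep_subset_succ X n ih

theorem resStep_subset_resStep_add {X Y : ModuleCat.{0} R} {m : ℕ} (hY : Y ∈ resStep R X m)
    (n : ℕ) : resStep R Y n ⊆ resStep R X (m + n) := by
  induction n with
  | zero =>
    rw [resStep_zero]
    refine (addClosure_mono ?_).trans (addClosure_resStep_subset X m)
    rintro M (rfl | rfl)
    exacts [hY, self_mem_resStep X m]
  | succ n ih =>
    rw [← add_assoc, resStep_succ, resStep_succ]
    refine addClosure_mono ?_
    rintro M (⟨A, B, hA, hB, h⟩ | ⟨A, B, hA, hB, h⟩)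
    exacts [.inl ⟨A, B, ih hA, ih hB, h⟩, .inr ⟨A, B, ih hA, ih hB, h⟩]

theorem step_le {X Y : ModuleCat.{0} R} {n : ℕ} (h : Y ∈ resStep R X n) : step R X Y ≤ n :=
  sInf_le ⟨n, rfl, h⟩

theorem step_eq_top_or_exists (X Y : ModuleCat.{0} R) :
    step R X Y = ⊤ ∨ ∃ n : ℕ, step R X Y = n ∧ Y ∈ resStep R X n := by
  rcases Set.eq_empty_or_nonempty {n : ℕ∞ | ∃ m : ℕ, n = (m : ℕ∞) ∧ Y ∈ resStep R X m} with h | h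
  · exact .inl (by rw [step, h, sInf_empty])
  · exact .inr (csInf_mem h)

end ResStep

/-- The triangle inequality for `step`, in `ℕ∞`. -/
theorem stmt12 (R : Type) [CommRing R] [IsNoetherianRing R]
    (X Y Z : ModuleCat R) (hX : Module.Finite R X) (hY : Module.Finite R Y)
    (hZ : Module.Finite R Z) :
    step R X Z ≤ step R X Y + step R Y Z := by
  rcases step_eq_top_or_exists X Y with h | ⟨m, hm, hXY⟩
  · simp [h]
  rcases step_eq_top_or_exists Y Z with h | ⟨n, hn, hYZ⟩
  · simp [h]
  rw [hm, hn]
  exact_mod_cast step_le (resStep_subset_resStep_add hXY n hYZ)
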